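/- There is a family (A_α)_{α∈2^ω} of subsets of 2^ω × 2^ω such that each A_α belongs to D₂(Σ⁰₁), each A_α is ≤ʳ_c-minimal among non-pot(Π⁰₁) Borel sets, and the family is a ≤ʳ_c-antichain: for α ≠ α' in 2^ω, neither A_α ≤ʳ_c A_{α'} nor A_{α'} ≤ʳ_c A_α. -/

import Mathlib

open Set Topology

abbrev Cantor : Type := ℕ → Bool

/-- `A ⊆ X × Y` is potentially closed (`pot(Π⁰₁)`): there are finer Polish topologies on `X`
and `Y` making `A` closed in the product. -/
def PotClosed {X Y : Type} (tX : TopologicalSpace X) (tY : TopologicalSpace Y)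
    (A : Set (X × Y)) : Prop :=
  ∃ (σ : TopologicalSpace X) (τ : TopologicalSpace Y),
    σ ≤ tX ∧ τ ≤ tY ∧ @PolishSpace X σ ∧ @PolishSpace Y τ ∧
    @IsClosed (X × Y) (@instTopologicalSpaceProd X Y σ τ) A

/-- Membership in the class `D₂(Σ⁰₁)`: difference of two open sets. -/
def D2Sigma01 {Z : Type} (t : TopologicalSpace Z) (A : Set Z) : Prop :=
  ∃ U V : Set Z, @IsOpen Z t U ∧ @IsOpen Z t V ∧ A = U \ V

/-- The rectangular continuous reducibility `A ≤ʳ_c A'`. -/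
def RedRC {X Y X' Y' : Type} (tX : TopologicalSpace X) (tY : TopologicalSpace Y)
    (tX' : TopologicalSpace X') (tY' : TopologicalSpace Y')
    (A : Set (X × Y)) (A' : Set (X' × Y')) : Prop :=
  ∃ (u : X → X') (v : Y → Y'),
    @Continuous X X' tX tX' u ∧ @Continuous Y Y' tY tY' v ∧
    A = (fun p => (u p.1, v p.2)) ⁻¹' A'

/-- `≤ʳ_c` on subsets of `Cantor × Cantor` with the standard topology. -/
def RedC2 (A A' : Set (Cantor × Cantor)) : Prop :=
  RedRC inferInstance inferInstance inferInstance inferInstance A A'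

/-- `A` is `≤ʳ_c`-minimal among non-potentially closed Borel sets. -/
def MinNonPotClosed {X Y : Type} (tX : TopologicalSpace X) (tY : TopologicalSpace Y)
    (A : Set (X × Y)) : Prop :=
  ¬ PotClosed tX tY A ∧
  ∀ (X' Y' : Type) (tX' : TopologicalSpace X') (tY' : TopologicalSpace Y'),
    @PolishSpace X' tX' → @PolishSpace Y' tY' →
    ∀ A' : Set (X' × Y'),
      @MeasurableSet (X' × Y') (@borel (X' × Y') (@instTopologicalSpaceProd X' Y' tX' tY')) A' →
      ¬ PotClosed tX' tY' A' →
      RedRC tX' tY' tX tY A' A → RedRC tX tY tX' tY' A A'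

/-- The Borel reducibility `A ≤_B A'` for square sets. -/
def RedB {Z Z' : Type} (tZ : TopologicalSpace Z) (tZ' : TopologicalSpace Z')
    (A : Set (Z × Z)) (A' : Set (Z' × Z'))  : Prop :=
  ∃ u : Z → Z', @Measurable Z Z' (@borel Z tZ) (@borel Z' tZ') u ∧
    A = (fun p => (u p.1, u p.2)) ⁻¹' A'

/-- `A` is `≤_B`-minimal among non-potentially closed Borel (square) sets. -/
def MinBNonPotClosed {Z : Type} (tZ : TopologicalSpace Z) (A : Set (Z × Z)) : Prop :=
  ¬ PotClosed tZ tZ A ∧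
  ∀ (Z' : Type) (tZ' : TopologicalSpace Z'), @PolishSpace Z' tZ' →
    ∀ A' : Set (Z' × Z'),
      @MeasurableSet (Z' × Z') (@borel (Z' × Z') (@instTopologicalSpaceProd Z' Z' tZ' tZ')) A' →
      ¬ PotClosed tZ' tZ' A' →
      RedB tZ' tZ A' A → RedB tZ tZ' A A'

/-- The graph of the partial function `f` with domain `D`. -/
def graphRel {X : Type} (D : Set X) (f : X → X) : Set (X × X) :=
  {p | p.1 ∈ D ∧ p.2 = f p.1}

/-- `A^f := ⋃ₙ Graph(fₙ)`. -/
def unionGraphs {X : Type} (D : ℕ → Set X) (f : ℕ → X → X) : Set (X × X) :=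
  ⋃ n, graphRel (D n) (f n)

/-- `f` restricted to `D` is a partial homeomorphism with clopen domain and clopen range. -/
def IsPartialHomeo {X : Type} (t : TopologicalSpace X) (D : Set X) (f : X → X) : Prop :=
  @IsClopen X t D ∧ @IsClopen X t (f '' D) ∧ @ContinuousOn X X t t f D ∧
    ∃ g : X → X, @ContinuousOn X X t t g (f '' D) ∧ ∀ x ∈ D, g (f x) = x

/-- A converging situation: a nonempty zero-dimensional perfect Polish space together with
partial homeomorphisms with clopen domains and ranges such that
`Δ(X) = closure(A^f) \ A^f`. -/
def ConvSit (X : Type) (t : TopologicalSpace X) (D : ℕ → Set X) (f : ℕ → X → X) : Prop :=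
  Nonempty X ∧ @PolishSpace X t ∧
  @TopologicalSpace.IsTopologicalBasis X t {s : Set X | @IsClopen X t s} ∧
  @Perfect X t Set.univ ∧
  (∀ n, IsPartialHomeo t (D n) (f n)) ∧
  Set.diagonal X =
    @closure (X × X) (@instTopologicalSpaceProd X X t t) (unionGraphs D f) \ unionGraphs D f

/-- The domain of the restriction `f^B` of the partial map `(D, f)` to a subset `B`. -/
def subD {X : Type} (B : Set X) (D : Set X) (f : X → X) : Set ↥B :=
  {x | (x : X) ∈ D ∧ f (x : X) ∈ B}

/-- The restriction `f^B` of `f` to `B`, as a map of the subtype (junk value outside). -/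
noncomputable def subF {X : Type} (B : Set X) (f : X → X) : ↥B → ↥B :=
  fun x =>
    letI := Classical.dec (f (x : X) ∈ B)
    if h : f (x : X) ∈ B then ⟨f (x : X), h⟩ else x

/-- `A^f ∩ B²`, viewed on the subtype `B`: the union of the graphs of the `f^B_n`'s. -/
def restrGraphs {X : Type} (B : Set X) (D : ℕ → Set X) (f : ℕ → X → X) : Set (↥B × ↥B) :=
  unionGraphs (fun n => subD B (D n) (f n)) (fun n => subF B (f n))

/-- The subspace topology on `B` induced by a topology `t` on `X`. -/
def subTop {X : Type} (t : TopologicalSpace X) (B : Set X) : TopologicalSpace ↥B :=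
  @TopologicalSpace.induced ↥B X Subtype.val t

/-- The natural bijection `ψ : ω → 2^{<ω}` (enumeration by length, then lexicographically):
`ψ(n)` is the binary expansion of `n+1` with its leading one removed. -/
def psiSeq (n : ℕ) : List Bool := ((n + 1).bits.dropLast).reverse

/-- `s_n := ψ(n)0^{n-|ψ(n)|}`, a dense sequence with `|s_n| = n`. -/
def sSeq (n : ℕ) : List Bool := psiSeq n ++ List.replicate (n - (psiSeq n).length) false

/-- The concatenation `sγ` of a finite sequence `s` with `γ ∈ 2^ω`. -/
def catSeq (s : List Bool) (γ : Cantor) : Cantor :=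
  fun i => if h : i < s.length then s.get ⟨i, h⟩ else γ (i - s.length)

/-- `A₁ := {(s_n0γ, s_n1γ) : n ∈ ω, γ ∈ 2^ω}`. -/
def A1 : Set (Cantor × Cantor) :=
  {p | ∃ (n : ℕ) (γ : Cantor),
    p.1 = catSeq (sSeq n ++ [false]) γ ∧ p.2 = catSeq (sSeq n ++ [true]) γ}

/-- `Card(x↾n)`: the number of ones among the first `n` coordinates of `x`. -/
def cardOnes (x : Cantor) (n : ℕ) : ℕ := ∑ i ∈ Finset.range n, (if x i then 1 else 0)

/-- The domain of `f^S_n`: sequences vanishing at `n` whose first `n` coordinates contain a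
number of ones belonging to `S`. -/
def DSdom (S : Set ℕ) (n : ℕ) : Set Cantor := {x | x n = false ∧ cardOnes x n ∈ S}

/-- `f^S_n (s0γ) := s1γ`: flip the `n`-th coordinate to one. -/
def fSfun (n : ℕ) : Cantor → Cantor := fun x => Function.update x n true

/-- `A^S := {(s0γ, s1γ) : s ∈ 2^{<ω}, Card(s) ∈ S, γ ∈ 2^ω} = ⋃ₙ Graph(f^S_n)`. -/
def ASet (S : Set ℕ) : Set (Cantor × Cantor) := unionGraphs (DSdom S) fSfun

/-- Condition (M) on `S ⊆ ω`. -/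
def CondM (S : Set ℕ) : Prop :=
  ∀ p : ℕ, ∃ k : ℕ, ∀ q : ℕ, ∃ c : ℕ, q ≤ c ∧ c ≤ q + k ∧
    (fun m => c + m) '' (S ∩ Set.Iic p) = S ∩ Set.Icc c (c + p)

/-- Condition (H) on `S ⊆ ω`. -/
def CondH (S : Set ℕ) : Prop :=
  ∀ C : Set Cantor, @MeasurableSet Cantor (borel Cantor) C →
    ∀ σ : TopologicalSpace ↥C, σ ≤ subTop inferInstance C →
      ConvSit ↥C σ (fun n => subD C (DSdom S n) (fSfun n)) (fun n => subF C (fSfun n)) →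
      ∀ l p : ℕ, ∃ n : ℕ, l ≤ n ∧ ∃ γ : ↥C, γ ∈ subD C (DSdom S n) (fSfun n) ∧
        (fun m => cardOnes (γ : Cantor) n + m) '' (S ∩ Set.Iic p) =
          S ∩ Set.Icc (cardOnes (γ : Cantor) n) (cardOnes (γ : Cantor) n + p)

/-- Condition (⊥) on a pair `(S, S')`. -/
def CondPerp (S S' : Set ℕ) : Prop :=
  ∃ p : ℕ, ∀ c : ℕ, (fun m => c + m) '' (S ∩ Set.Iic p) ≠ S' ∩ Set.Icc c (c + p)

/-- Condition (⊥⁻¹) on a pair `(S, S')` (stated in `ℤ` to handle subtraction). -/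
def CondPerpInv (S S' : Set ℕ) : Prop :=
  ∃ p : ℕ, ∀ c : ℕ,
    (fun m : ℕ => (c : ℤ) - (m : ℤ)) '' (S ∩ Set.Iic p) ≠
      ((fun n : ℕ => (n : ℤ)) '' S') ∩ Set.Icc ((c : ℤ) - (p : ℤ)) (c : ℤ)

/-- `A⁻¹ := {(y,x) : (x,y) ∈ A}`. -/
def invRel {X : Type} (A : Set (X × X)) : Set (X × X) := {p | (p.2, p.1) ∈ A}

/-- `γ_α`: `γ_α(4n+2ε) = ε` and `γ_α(2n+1) = α(n)`. -/
def gammaSeq (α : Cantor) (k : ℕ) : Bool :=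
  if k % 2 = 1 then α (k / 2) else decide (k % 4 = 2)

/-- `β_α(i) := γ_α((i)₀)` where `(i)₀ = max {m : 2^m ∣ i+1}`, with values in `{0,1} ⊆ ω`. -/
def betaSeq (α : Cantor) (i : ℕ) : ℕ :=
  if gammaSeq α ((i + 1).factorization 2) then 1 else 0

/-- `S_β := {Σ_{i<l} (1 + β(i)) : l ∈ ω}`. -/
def Sbeta (β : ℕ → ℕ) : Set ℕ :=
  {m | ∃ l : ℕ, m = ∑ i ∈ Finset.range l, (1 + β i)}

/-- `s_n` as a function `ℕ → Bool` (with junk value `false` beyond `n`). -/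
def sSeqFn (n : ℕ) (i : ℕ) : Bool := (sSeq n).getD i false

/-- The domain of `f¹_n` (direction `d = true`) or of `(f¹_n)⁻¹` (direction `d = false`):
`x` extends `s_n` and `x(n) = !d`. -/
def step1Dom (n : ℕ) (d : Bool) : Set Cantor :=
  {x | (∀ i, i < n → x i = sSeqFn n i) ∧ x n = !d}

/-- `f¹_n` (if `d = true`) or its inverse (if `d = false`): set the `n`-th coordinate to `d`. -/
def step1Fun (n : ℕ) (d : Bool) : Cantor → Cantor := fun x => Function.update x n d

/-- Domain of `fₙ` (direction `d = true`) or of `fₙ⁻¹` (direction `d = false`). -/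
def stepDom {X : Type} (D : ℕ → Set X) (f : ℕ → X → X) (n : ℕ) (d : Bool) : Set X :=
  if d then D n else f n '' D n

/-- `fₙ` (direction `d = true`) or its inverse `gₙ` (direction `d = false`). -/
def stepFun {X : Type} (f g : ℕ → X → X) (n : ℕ) (d : Bool) : X → X :=
  if d then f n else g n

/-- An acyclic situation (Definition 26), with `g n` the inverse of `f n`. -/
def AcyclicSit (X : Type) (t : TopologicalSpace X) (D : ℕ → Set X) (f g : ℕ → X → X) : Prop :=
  Nonempty X ∧ @PolishSpace X t ∧
  @TopologicalSpace.IsTopologicalBasis X t {s : Set X | @IsClopen X t s} ∧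
  @Perfect X t Set.univ ∧
  (∀ n, IsPartialHomeo t (D n) (f n)) ∧
  (∀ n, ∀ x ∈ D n, g n (f n x) = x) ∧
  Set.diagonal X ⊆
    @closure (X × X) (@instTopologicalSpaceProd X X t t) (unionGraphs D f) \ unionGraphs D f ∧
  (∀ m : ℕ, 1 ≤ m → ∀ (v : ℕ → ℕ) (ε : ℕ → Bool),
    (∀ i, i + 1 < m → v i ≠ v (i + 1) ∨ ε i = ε (i + 1)) →
    ∀ U : Set X, @IsClopen X t U → U.Nonempty →
      ∃ V : Set X, @IsClopen X t V ∧ V.Nonempty ∧ V ⊆ U ∧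
        ∀ x ∈ V, ∀ w : ℕ → X, w 0 = x →
          (∀ i, i < m → w i ∈ stepDom D f (v i) (ε i) ∧
            w (i + 1) = stepFun f g (v i) (ε i) (w i)) →
          w m ∉ V)

/-- The relation `ℜ_Θ` on `2^{<ω}`: `e ℜ_Θ e'` iff `e = e'` or
`(e, e') = (θ_n0w, θ_n1w)` for some `n` and `w`. -/
def RTheta (θ : ℕ → List Bool) (e e' : List Bool) : Prop :=
  e = e' ∨ ∃ (n : ℕ) (w : List Bool), e = θ n ++ false :: w ∧ e' = θ n ++ true :: w

/-- The symmetrization `s(ℜ_Θ)`. -/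
def sRTheta (θ : ℕ → List Bool) (e e' : List Bool) : Prop :=
  RTheta θ e e' ∨ RTheta θ e' e

instance polishSpace_cantor : PolishSpace Cantor :=
  { (inferInstance : SecondCountableTopology Cantor),
    (inferInstance : TopologicalSpace.IsCompletelyMetrizableSpace Cantor) with }

theorem mem_ASet {S : Set ℕ} {x y : Cantor} :
    (x, y) ∈ ASet S ↔ ∃ n, x n = false ∧ cardOnes x n ∈ S ∧ y = Function.update x n true := by
  simp [ASet, unionGraphs, graphRel, DSdom, fSfun, and_assoc]

theorem cardOnes_eq_card (x : Cantor) (n : ℕ) :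
    cardOnes x n = ((Finset.range n).filter (fun i => x i = true)).card := by
  simp [cardOnes]

theorem cardOnes_congr {x y : Cantor} {n : ℕ} (h : ∀ i < n, x i = y i) :
    cardOnes x n = cardOnes y n :=
  Finset.sum_congr rfl fun i hi => by rw [h i (Finset.mem_range.1 hi)]

theorem cardOnes_update {x : Cantor} {m n : ℕ} (hmn : m < n) (hx : x m = false) :
    cardOnes (Function.update x m true) n = cardOnes x n + 1 := by
  have hm : m ∈ Finset.range n := Finset.mem_range.2 hmn
  unfold cardOnes
  rw [← Finset.add_sum_erase _ _ hm, ← Finset.add_sum_erase _ _ hm, Function.update_self, hx,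
    Finset.sum_congr rfl (g := fun i => if x i = true then 1 else 0)]
  · simp [add_comm]
  · intro i hi
    rw [Function.update_of_ne (Finset.ne_of_mem_erase hi)]

theorem continuous_cardOnes (n : ℕ) : Continuous fun x : Cantor => cardOnes x n :=
  continuous_finsetSum _ fun i _ =>
    (continuous_of_discreteTopology (f := fun b : Bool => if b then 1 else 0)).comp
      (continuous_apply i)

theorem isClopen_DSdom (S : Set ℕ) (n : ℕ) : IsClopen (DSdom S n) :=
  ((isClopen_discrete ({false} : Set Bool)).preimage (continuous_apply n)).inter
    ((isClopen_discrete S).preimage (continuous_cardOnes n))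

theorem continuous_fSfun (n : ℕ) : Continuous (fSfun n) :=
  continuous_id.update n continuous_const

theorem isClosed_graphRel (S : Set ℕ) (n : ℕ) : IsClosed (graphRel (DSdom S n) (fSfun n)) :=
  ((isClopen_DSdom S n).isClosed.preimage continuous_fst).inter
    (isClosed_eq continuous_snd ((continuous_fSfun n).comp continuous_fst))

theorem isClosed_ASet_union_diagonal (S : Set ℕ) : IsClosed (ASet S ∪ diagonal Cantor) := by
  have key : (ASet S ∪ diagonal Cantor)ᶜ =
      ⋃ m : ℕ, {p : Cantor × Cantor | p.1 m ≠ p.2 m} ∩ (graphRel (DSdom S m) (fSfun m))ᶜ := by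
    ext ⟨x, y⟩
    simp only [mem_compl_iff, mem_union, mem_diagonal_iff, mem_iUnion, mem_inter_iff,
      mem_ofPred_eq, not_or]
    constructor
    · rintro ⟨hA, hne⟩
      obtain ⟨m, hm⟩ := Function.ne_iff.1 hne
      exact ⟨m, hm, fun h => hA (mem_iUnion.2 ⟨m, h⟩)⟩
    · rintro ⟨m, hm, hg⟩
      refine ⟨fun hA => ?_, fun h => hm (by rw [h])⟩
      obtain ⟨n, hn⟩ := mem_iUnion.1 hA
      have hy : y = Function.update x n true := hn.2
      obtain rfl : m = n := by
        by_contra hmn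
        exact hm (by rw [hy, Function.update_of_ne hmn])
      exact hg hn
  rw [← isOpen_compl_iff, key]
  refine isOpen_iUnion fun m => IsOpen.inter ?_ (isClosed_graphRel S m).isOpen_compl
  exact isOpen_ne_fun ((continuous_apply m).comp continuous_fst)
    ((continuous_apply m).comp continuous_snd)

theorem not_mem_ASet_self (S : Set ℕ) (x : Cantor) : (x, x) ∉ ASet S := by
  rw [mem_ASet]
  rintro ⟨n, hn, -, h⟩
  have := congrFun h n
  simp [hn] at this

theorem d2Sigma01_ASet (S : Set ℕ) : D2Sigma01 inferInstance (ASet S) := by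
  refine ⟨(diagonal Cantor)ᶜ, (ASet S ∪ diagonal Cantor)ᶜ, isClosed_diagonal.isOpen_compl,
    (isClosed_ASet_union_diagonal S).isOpen_compl, ?_⟩
  ext ⟨x, y⟩
  simp only [mem_sdiff, mem_compl_iff, mem_union, mem_diagonal_iff, not_not]
  constructor
  · intro h
    exact ⟨fun hxy => not_mem_ASet_self S x (by rwa [← hxy] at h), Or.inl h⟩
  · rintro ⟨h, h' | h'⟩
    exacts [h', absurd h' h]

/-- `B` contains no edge of `A^T`. -/
def Independent (T : Set ℕ) (B : Set Cantor) : Prop :=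
  ∀ x ∈ B, ∀ y ∈ B, (x, y) ∉ ASet T

/-- `X` is covered by countably many Borel `A^T`-independent sets. -/
def CountablyColorable (T : Set ℕ) (X : Set Cantor) : Prop :=
  ∃ C : Set (Set Cantor), C.Countable ∧ (∀ B ∈ C, MeasurableSet B ∧ Independent T B) ∧ X ⊆ ⋃₀ C

theorem Independent.mono {T T' : Set ℕ} (h : T ⊆ T') {B : Set Cantor} (hB : Independent T' B) :
    Independent T B := fun x hx y hy hxy =>
  hB x hx y hy <| by
    obtain ⟨n, h1, h2, h3⟩ := mem_ASet.1 hxy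
    exact mem_ASet.2 ⟨n, h1, h h2, h3⟩

open MeasureTheory in
theorem analyticSet_inter {α : Type*} [TopologicalSpace α] [T2Space α] {s t : Set α}
    (hs : AnalyticSet s) (ht : AnalyticSet t) : AnalyticSet (s ∩ t) := by
  rw [inter_eq_iInter]
  exact AnalyticSet.iInter fun b => by cases b <;> assumption

namespace CountablyColorable

theorem mono {T T' : Set ℕ} (h : T ⊆ T') {X : Set Cantor} (hX : CountablyColorable T' X) :
    CountablyColorable T X := by
  obtain ⟨C, hC, hB, hXC⟩ := hX
  exact ⟨C, hC, fun B hBC => ⟨(hB B hBC).1, (hB B hBC).2.mono h⟩, hXC⟩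

theorem subset {T : Set ℕ} {X X' : Set Cantor} (h : X ⊆ X') (hX : CountablyColorable T X') :
    CountablyColorable T X := by
  obtain ⟨C, hC, hB, hXC⟩ := hX
  exact ⟨C, hC, hB, h.trans hXC⟩

theorem of_independent {T : Set ℕ} {B : Set Cantor} (hB : MeasurableSet B)
    (h : Independent T B) : CountablyColorable T B :=
  ⟨{B}, countable_singleton B, by simp [hB, h], by simp⟩

theorem iUnion {ι : Type*} [Countable ι] {T : Set ℕ} {X : ι → Set Cantor}
    (h : ∀ i, CountablyColorable T (X i)) : CountablyColorable T (⋃ i, X i) := by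
  choose C hC hB hX using h
  refine ⟨⋃ i, C i, countable_iUnion hC, ?_, iUnion_subset fun i => (hX i).trans ?_⟩
  · intro B hBC
    obtain ⟨i, hi⟩ := mem_iUnion.1 hBC
    exact hB i B hi
  · exact sUnion_subset_sUnion (subset_iUnion C i)

theorem union {T : Set ℕ} {X X' : Set Cantor} (h : CountablyColorable T X)
    (h' : CountablyColorable T X') : CountablyColorable T (X ∪ X') := by
  rw [union_eq_iUnion]
  exact iUnion fun b => by cases b <;> assumption

theorem exists_measurable_superset {T : Set ℕ} {X : Set Cantor} (h : CountablyColorable T X) :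
    ∃ B, MeasurableSet B ∧ X ⊆ B ∧ CountablyColorable T B := by
  obtain ⟨C, hC, hB, hX⟩ := h
  exact ⟨⋃₀ C, MeasurableSet.sUnion hC fun B hBC => (hB B hBC).1, hX, C, hC, hB, subset_rfl⟩

/-- An independent set splits according to the first position at which one more flip stays in the
set; the pieces are independent for the edges with one less preceding one. -/
theorem union_shift {T : Set ℕ} {X : Set Cantor} (h : CountablyColorable T X) :
    CountablyColorable (T ∪ {c | c + 1 ∈ T}) X := by
  obtain ⟨C, hC, hB, hX⟩ := h
  have := hC.to_subtype
  rw [sUnion_eq_iUnion] at hX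
  refine subset hX (iUnion fun ⟨B, hBC⟩ => ?_)
  obtain ⟨hBm, hBi⟩ := hB B hBC
  let Y : ℕ → Set Cantor := fun m => {z | z ∈ B ∧ z m = false ∧ fSfun m z ∈ B}
  have hYm : ∀ m, MeasurableSet (Y m) := fun m =>
    hBm.inter ((measurableSet_eq_fun (measurable_pi_apply m) measurable_const).inter
      ((continuous_fSfun m).measurable hBm))
  let Z : (Σ m : ℕ, Fin (m + 1) → Bool) → Set Cantor :=
    fun i => Y i.1 ∩ ⋂ j : Fin (i.1 + 1), {z | z j = i.2 j}
  have hcov : B ⊆ (B \ ⋃ m, Y m) ∪ ⋃ i, Z i := by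
    intro z hz
    by_cases hY : z ∈ ⋃ m, Y m
    · obtain ⟨m, hm⟩ := mem_iUnion.1 hY
      exact Or.inr (mem_iUnion.2 ⟨⟨m, fun j => z j⟩, hm, by simp⟩)
    · exact Or.inl ⟨hz, hY⟩
  refine subset hcov (union (of_independent (hBm.diff (MeasurableSet.iUnion hYm)) ?_)
    (iUnion fun i => of_independent ((hYm _).inter (MeasurableSet.iInter fun j =>
      measurableSet_eq_fun (measurable_pi_apply _) measurable_const)) ?_))
  · rintro x hx y hy hxy
    obtain ⟨n, h1, -, rfl⟩ := mem_ASet.1 hxy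
    exact hx.2 (mem_iUnion.2 ⟨n, hx.1, h1, hy.1⟩)
  · obtain ⟨m, s⟩ := i
    rintro x ⟨hx, hxs⟩ y ⟨hy, hys⟩ hxy
    simp only [mem_iInter, mem_ofPred_eq] at hxs hys
    obtain ⟨n, h1, h2, rfl⟩ := mem_ASet.1 hxy
    have hmn : m < n := by
      by_contra hle
      have e := (hxs ⟨n, by omega⟩).trans (hys ⟨n, by omega⟩).symm
      simp [h1] at e
    rcases h2 with h2 | h2
    · exact hBi x hx.1 _ hy.1 (mem_ASet.2 ⟨n, h1, h2, rfl⟩)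
    · refine hBi _ hx.2.2 _ hy.2.2 (mem_ASet.2 ⟨n, ?_, ?_, ?_⟩)
      · rw [fSfun, Function.update_of_ne hmn.ne', h1]
      · rwa [fSfun, cardOnes_update hmn hx.2.1]
      · exact Function.update_comm hmn.ne' _ _ _

theorem of_syndetic {T : Set ℕ} {X : Set Cantor} (h : CountablyColorable T X) {k : ℕ}
    (hT : ∀ c, ∃ j ≤ k, c + j ∈ T) : CountablyColorable univ X := by
  have key : ∀ k, CountablyColorable {c | ∃ j ≤ k, c + j ∈ T} X := by
    intro k
    induction k with
    | zero => simpa using h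
    | succ k ih =>
      refine ih.union_shift.mono ?_
      rintro c ⟨j, hj, hc⟩
      rcases j with _ | j
      · exact Or.inl ⟨0, Nat.zero_le _, hc⟩
      · exact Or.inr ⟨j, by omega, by rwa [add_assoc, add_comm 1 j]⟩
  exact (key k).mono fun c _ => hT c

open MeasureTheory in
theorem of_analyticSet {T : Set ℕ} {X : Set Cantor} (hX : AnalyticSet X)
    (h : Independent T X) : CountablyColorable T X := by
  have hN : AnalyticSet (⋃ n, fSfun n '' (X ∩ DSdom T n)) :=
    AnalyticSet.iUnion fun n =>
      (analyticSet_inter hX (isClopen_DSdom T n).isClosed.analyticSet).image_of_continuous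
        (continuous_fSfun n)
  obtain ⟨W, hXW, hWN, hW⟩ := hX.measurablySeparable hN <| by
    rw [disjoint_left]
    rintro _ hy hy'
    obtain ⟨n, x, ⟨hx, hn⟩, rfl⟩ := mem_iUnion.1 hy'
    exact h x hx _ hy (mem_iUnion.2 ⟨n, hn, rfl⟩)
  let E : Set Cantor := ⋃ n, DSdom T n ∩ fSfun n ⁻¹' W
  have hE : MeasurableSet E := MeasurableSet.iUnion fun n =>
    (isClopen_DSdom T n).isClosed.measurableSet.inter ((continuous_fSfun n).measurable hW)
  refine subset (X' := W \ E) (fun x hx => ⟨hXW hx, fun hxE => ?_⟩)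
    (of_independent (hW.diff hE) ?_)
  · obtain ⟨n, hn, hnW⟩ := mem_iUnion.1 hxE
    exact disjoint_left.1 hWN (mem_iUnion.2 ⟨n, x, ⟨hx, hn⟩, rfl⟩) hnW
  · rintro x hx y hy hxy
    obtain ⟨n, h1, h2⟩ := mem_iUnion.1 hxy
    obtain rfl : y = fSfun n x := h2
    exact hx.2 (mem_iUnion.2 ⟨n, h1, hy.1⟩)

end CountablyColorable

theorem exists_cylinder_subset {O : Set Cantor} (hO : IsOpen O) {x : Cantor} (hx : x ∈ O) :
    ∃ l : ℕ, ∀ y : Cantor, (∀ i < l, y i = x i) → y ∈ O := by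
  obtain ⟨l, hl⟩ := PiNat.exists_disjoint_cylinder (E := fun _ => Bool) hO.isClosed_compl
    (x := x) (fun h => h hx)
  refine ⟨l, fun y hy => ?_⟩
  by_contra hyO
  exact disjoint_left.1 hl hyO (PiNat.mem_cylinder_iff.2 hy)

theorem exists_edge {S : Set ℕ} (hS : ∀ N, ∃ c ≥ N, c ∈ S) (x : Cantor) (l : ℕ) :
    ∃ n ≥ l, ∃ y : Cantor, (∀ i < l, y i = x i) ∧ y n = false ∧ cardOnes y n ∈ S := by
  obtain ⟨c, hc, hcS⟩ := hS (cardOnes x l)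
  obtain ⟨k, rfl⟩ := Nat.exists_eq_add_of_le hc
  let y : Cantor := fun i => if i < l then x i else decide (i < l + k)
  refine ⟨l + k, Nat.le_add_right _ _, y, fun i hi => if_pos hi, by simp [y], ?_⟩
  have h : cardOnes y (l + k) = cardOnes x l + k := by
    unfold cardOnes
    rw [Finset.sum_range_add]
    congr 1
    · refine Finset.sum_congr rfl fun i hi => ?_
      simp [y, Finset.mem_range.1 hi]
    · rw [Finset.sum_congr rfl (g := fun _ => 1)]
      · simp
      · intro i hi
        simp [y, Finset.mem_range.1 hi]
  rwa [h]

/-- Flip the `n`-th coordinate. -/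
def flipHomeo (n : ℕ) : Cantor ≃ₜ Cantor where
  toFun z := Function.update z n (!z n)
  invFun z := Function.update z n (!z n)
  left_inv z := by simp
  right_inv z := by simp
  continuous_toFun := continuous_id.update n
    ((continuous_of_discreteTopology (f := Bool.not)).comp (continuous_apply n))
  continuous_invFun := continuous_id.update n
    ((continuous_of_discreteTopology (f := Bool.not)).comp (continuous_apply n))

theorem flipHomeo_apply (n : ℕ) (z : Cantor) : flipHomeo n z = Function.update z n (!z n) := rfl

theorem not_countablyColorable_univ {S : Set ℕ} (hS : ∀ N, ∃ c ≥ N, c ∈ S) :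
    ¬ CountablyColorable S univ := by
  rintro ⟨C, hC, hB, hcov⟩
  obtain ⟨W, hW, O, hO, hWO, x, hx⟩ : ∃ W ∈ C, ∃ O : Set Cantor, IsOpen O ∧
      (∀ᶠ z in residual Cantor, z ∈ W ↔ z ∈ O) ∧ O.Nonempty := by
    by_contra! hcon
    have hmeagre : ∀ W ∈ C, ∀ᶠ z in residual Cantor, z ∉ W := by
      intro W hW
      obtain ⟨O, hO, hWO⟩ := (hB W hW).1.residualEq_isOpen
      rw [Filter.eventuallyEq_set] at hWO
      have := hcon W hW O hO hWO
      subst this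
      exact hWO.mono fun z hz hzW => hz.1 hzW
    have h := (eventually_countable_ball hC).2 hmeagre
    obtain ⟨z, hz⟩ := (dense_of_mem_residual h).nonempty
    obtain ⟨W, hW, hzW⟩ := hcov (mem_univ z)
    exact hz W hW hzW
  obtain ⟨l, hl⟩ := exists_cylinder_subset hO hx
  obtain ⟨n, hn, y, hy, hyn, hyS⟩ := exists_edge hS x l
  have hflip := (tendsto_residual_of_isOpenMap (flipHomeo n).continuous
    (flipHomeo n).isOpenMap).eventually hWO
  obtain ⟨z, hz, hzW⟩ := (dense_of_mem_residual (hWO.and hflip)).exists_mem_open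
    (PiNat.isOpen_cylinder (fun _ => Bool) y (n + 1)) ⟨y, PiNat.self_mem_cylinder y (n + 1)⟩
  rw [PiNat.mem_cylinder_iff] at hzW
  have hzn : z n = false := (hzW n n.lt_succ_self).trans hyn
  have hzl : ∀ i < l, z i = x i := fun i hi => (hzW i (by omega)).trans (hy i hi)
  refine (hB W hW).2 z (hz.1.2 (hl z hzl)) _ (hz.2.2 (hl _ fun i hi => ?_))
    (mem_ASet.2 ⟨n, hzn, ?_, ?_⟩)
  · rw [flipHomeo_apply, Function.update_of_ne (by omega), hzl i hi]
  · rwa [cardOnes_congr fun i hi => hzW i (by omega)]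
  · rw [flipHomeo_apply, hzn, Bool.not_false]

theorem measurableSet_of_isOpen_of_le {α : Type*} {t ρ : TopologicalSpace α}
    (ht : @PolishSpace α t) (hρ : @PolishSpace α ρ) (hle : ρ ≤ t) {V : Set α}
    (hV : IsOpen[ρ] V) : @MeasurableSet α (@borel α t) V := by
  rw [← MeasureTheory.borel_eq_borel_of_le hρ ht hle]
  exact MeasurableSpace.measurableSet_generateFrom hV

theorem not_potClosed_ASet {S : Set ℕ} (hS : ∀ N, ∃ c ≥ N, c ∈ S) :
    ¬ PotClosed inferInstance inferInstance (ASet S) := by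
  have hBorel : ∀ V : Set Cantor, @MeasurableSet Cantor (borel Cantor) V → MeasurableSet V :=
    fun V hV => by rwa [BorelSpace.measurable_eq (α := Cantor)]
  have hP : PolishSpace Cantor := inferInstance
  have hrefine := fun m : Bool → TopologicalSpace Cantor =>
    PolishSpace.exists_polishSpace_forall_le m
  rintro ⟨σ, τ, hσ, hτ, hσP, hτP, hcl⟩
  obtain ⟨ρ, hρ, hρle, hρP⟩ := hrefine (fun b : Bool => cond b σ τ)
    (by rintro (_ | _); exacts [hτ, hσ])
    (by rintro (_ | _); exacts [hτP, hσP])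
  have hρσ : ρ ≤ σ := hρ true
  have hρτ : ρ ≤ τ := hρ false
  refine not_countablyColorable_univ hS ?_
  have hopen : ∀ V : Set Cantor, IsOpen[ρ] V → MeasurableSet V := fun V hV =>
    hBorel V (measurableSet_of_isOpen_of_le hP hρP hρle hV)
  have hsc : @SecondCountableTopology Cantor ρ := hρP.toSecondCountableTopology
  refine ⟨{V | V ∈ @TopologicalSpace.countableBasis Cantor ρ hsc ∧ Independent S V},
    (@TopologicalSpace.countable_countableBasis Cantor ρ hsc).mono fun V hV => hV.1,
    fun V hV => ⟨hopen V (@TopologicalSpace.isOpen_of_mem_countableBasis Cantor ρ hsc V hV.1),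
      hV.2⟩, fun x _ => ?_⟩
  have hop := hcl.isOpen_compl
  rw [@isOpen_prod_iff _ _ σ τ] at hop
  obtain ⟨u, v, hu, hv, hxu, hxv, huv⟩ := hop x x (not_mem_ASet_self S x)
  obtain ⟨V, hV, hxV, hVuv⟩ := (@TopologicalSpace.isBasis_countableBasis Cantor ρ
    hsc).exists_subset_of_mem_open (a := x) (u := u ∩ v) ⟨hxu, hxv⟩
    (@IsOpen.inter _ ρ _ _ (hρσ u hu) (hρτ v hv))
  exact ⟨V, ⟨hV, fun a ha b hb => huv (mk_mem_prod (hVuv ha).1 (hVuv hb).2)⟩, hxV⟩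

theorem exists_polishSpace_le_isOpen_preimage {X : Type*} [t : TopologicalSpace X] [PolishSpace X]
    {f : X → Cantor} (hf : Continuous f) {C : Set (Set Cantor)} (hC : C.Countable)
    (hB : ∀ B ∈ C, MeasurableSet B) :
    ∃ σ ≤ t, @PolishSpace X σ ∧ ∀ B ∈ C, IsOpen[σ] (f ⁻¹' B) := by
  borelize X
  have := hC.to_subtype
  choose m hm hmP hmO using fun B : C => (hf.measurable (hB B B.2)).isClopenable
  obtain ⟨σ, hσ, hσt, hσP⟩ := PolishSpace.exists_polishSpace_forall_le m hm hmP
  exact ⟨σ, hσt, hσP, fun B hBC => hσ ⟨B, hBC⟩ _ (hmO ⟨B, hBC⟩).2⟩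

theorem potClosed_preimage_ASet {X Y : Type} [tX : TopologicalSpace X] [tY : TopologicalSpace Y]
    [PolishSpace X] [PolishSpace Y] {u : X → Cantor} {v : Y → Cantor} (hu : Continuous u)
    (hv : Continuous v) {S : Set ℕ}
    (h : CountablyColorable S {z | ∃ x y, u x = z ∧ v y = z}) :
    PotClosed tX tY ((fun p : X × Y => (u p.1, v p.2)) ⁻¹' ASet S) := by
  have hcl := ((isClosed_ASet_union_diagonal S).preimage
    ((hu.comp continuous_fst).prodMk (hv.comp continuous_snd))).isOpen_compl
  rw [isOpen_prod_iff] at hcl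
  obtain ⟨C, hC, hB, hcov⟩ := h
  obtain ⟨σ, hσ, hσP, hσO⟩ :=
    exists_polishSpace_le_isOpen_preimage hu hC fun B hBC => (hB B hBC).1
  obtain ⟨τ, hτ, hτP, hτO⟩ :=
    exists_polishSpace_le_isOpen_preimage hv hC fun B hBC => (hB B hBC).1
  refine ⟨σ, τ, hσ, hτ, hσP, hτP,
    (@isOpen_compl_iff _ _ (@instTopologicalSpaceProd X Y σ τ)).1 ?_⟩
  rw [@isOpen_prod_iff X Y σ τ]
  intro x y hxy
  by_cases he : u x = v y
  · obtain ⟨B, hBC, hxB⟩ := hcov ⟨x, y, rfl, he.symm⟩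
    refine ⟨u ⁻¹' B, v ⁻¹' B, hσO B hBC, hτO B hBC, hxB, by rwa [mem_preimage, ← he], ?_⟩
    rintro ⟨a, b⟩ ⟨ha, hb⟩
    exact (hB B hBC).2 _ ha _ hb
  · obtain ⟨U, V, hU, hV, hxU, hyV, hUV⟩ := hcl x y <| by
      rintro (h | h)
      exacts [hxy h, he h]
    exact ⟨U, V, hσ U hU, hτ V hV, hxU, hyV, fun p hp hpA => hUV hp (Or.inl hpA)⟩

open Classical in
/-- Copy `α` into `z` along the positions `M`. -/
noncomputable def emb (z : Cantor) (M : ℕ → ℕ) (α : Cantor) : Cantor :=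
  fun i => z i || decide (∃ k, M k = i ∧ α k = true)

section emb

variable {z : Cantor} {M : ℕ → ℕ}

theorem emb_apply_of_not_mem_range {i : ℕ} (hi : i ∉ range M) (α : Cantor) :
    emb z M α i = z i := by
  have : ¬ ∃ k, M k = i ∧ α k = true := fun ⟨k, hk, _⟩ => hi ⟨k, hk⟩
  simp [emb, this]

theorem emb_apply (hM : StrictMono M) (hz : ∀ k, z (M k) = false) (α : Cantor) (k : ℕ) :
    emb z M α (M k) = α k := by
  simp [emb, hz, hM.injective.eq_iff]

theorem emb_injective (hM : StrictMono M) (hz : ∀ k, z (M k) = false) :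
    Function.Injective (emb z M) := fun α β h => funext fun k => by
  rw [← emb_apply hM hz α k, h, emb_apply hM hz]

theorem emb_update (hM : StrictMono M) (hz : ∀ k, z (M k) = false) (α : Cantor) (k : ℕ)
    (b : Bool) : emb z M (Function.update α k b) = Function.update (emb z M α) (M k) b := by
  ext1 i
  by_cases hi : i ∈ range M
  · obtain ⟨j, rfl⟩ := hi
    rw [emb_apply hM hz, Function.update_apply, Function.update_apply, emb_apply hM hz]
    simp only [hM.injective.eq_iff]
  · rw [emb_apply_of_not_mem_range hi, Function.update_of_ne, emb_apply_of_not_mem_range hi]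
    rintro rfl
    exact hi ⟨k, rfl⟩

theorem emb_zero : emb z M (fun _ => false) = z := by
  ext1 i
  simp [emb]

theorem cardOnes_emb (hM : StrictMono M) (hz : ∀ k, z (M k) = false) (α : Cantor) (k : ℕ) :
    cardOnes (emb z M α) (M k) = cardOnes z (M k) + cardOnes α k := by
  have h : (Finset.range (M k)).filter (fun i => emb z M α i = true) =
      (Finset.range (M k)).filter (fun i => z i = true) ∪
        ((Finset.range k).filter (fun i => α i = true)).image M := by
    ext i
    by_cases hi : i ∈ range M
    · obtain ⟨j, rfl⟩ := hi
      simp [emb_apply hM hz, hz, hM.injective.eq_iff, hM.lt_iff_lt]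
    · have : ∀ j, M j ≠ i := fun j hj => hi ⟨j, hj⟩
      simp [emb_apply_of_not_mem_range hi, this]
  simp only [cardOnes_eq_card]
  rw [h, Finset.card_union_of_disjoint, Finset.card_image_of_injective _ hM.injective]
  rw [Finset.disjoint_left]
  intro i hi hi'
  obtain ⟨j, -, rfl⟩ := Finset.mem_image.1 hi'
  simp [hz] at hi

theorem emb_mem_ASet (hM : StrictMono M) (hz : ∀ k, z (M k) = false) {S : Set ℕ} {α β : Cantor} :
    (emb z M α, emb z M β) ∈ ASet S ↔ ∃ k, α k = false ∧
      cardOnes z (M k) + cardOnes α k ∈ S ∧ β = Function.update α k true := by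
  rw [mem_ASet]
  constructor
  · rintro ⟨n, hn, hnS, h⟩
    by_cases hi : n ∈ range M
    · obtain ⟨k, rfl⟩ := hi
      rw [emb_apply hM hz] at hn
      rw [cardOnes_emb hM hz] at hnS
      rw [← emb_update hM hz] at h
      exact ⟨k, hn, hnS, emb_injective hM hz h⟩
    · have h' := congrFun h n
      rw [emb_apply_of_not_mem_range hi] at hn h'
      simp [hn] at h'
  · rintro ⟨k, hk, hkS, rfl⟩
    exact ⟨M k, by rwa [emb_apply hM hz], by rwa [cardOnes_emb hM hz], emb_update hM hz _ _ _⟩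

theorem cardOnes_le (x : Cantor) (n : ℕ) : cardOnes x n ≤ n := by
  rw [cardOnes_eq_card]
  exact (Finset.card_filter_le _ _).trans_eq (Finset.card_range n)

theorem emb_mem_ASet_iff (hM : StrictMono M) (hz : ∀ k, z (M k) = false) {S : Set ℕ}
    (hS : ∀ k, ∀ j ≤ k, (cardOnes z (M k) + j ∈ S ↔ j ∈ S)) {α β : Cantor} :
    (emb z M α, emb z M β) ∈ ASet S ↔ (α, β) ∈ ASet S := by
  rw [emb_mem_ASet hM hz, mem_ASet]
  exact exists_congr fun k => and_congr_right fun _ => and_congr_left fun _ =>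
    hS k _ (cardOnes_le α k)

end emb

/-- Add to `z` the ones at the positions in `F`. -/
def orFin (z : Cantor) (F : Finset ℕ) : Cantor := fun i => z i || decide (i ∈ F)

theorem orFin_empty (z : Cantor) : orFin z ∅ = z := by
  ext1 i
  simp [orFin]

theorem continuous_orFin (F : Finset ℕ) : Continuous fun z => orFin z F :=
  continuous_pi fun i => (continuous_of_discreteTopology
    (f := fun b : Bool => b || decide (i ∈ F))).comp (continuous_apply i)

theorem orFin_update_erase {z : Cantor} {F : Finset ℕ} {n : ℕ} (hn : n ∈ F) :
    orFin (Function.update z n true) (F.erase n) = orFin z F := by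
  ext1 i
  by_cases hi : i = n
  · subst hi
    simp [orFin, hn]
  · simp [orFin, hi]

/-- The base points of the finite cubes, with directions in `P`, whose vertices all lie in `Z` and
lift along `w` to the prescribed sets. -/
def cubeSet {E : Type*} (w : E → Cantor) (Z : Set Cantor) (P : Finset ℕ)
    (U : Finset ℕ → Set E) : Set Cantor :=
  {z | (∀ m ∈ P, z m = false) ∧ ∀ F ⊆ P, orFin z F ∈ w '' U F ∩ Z}

theorem cubeSet_mono {E : Type*} {w : E → Cantor} {Z Z' : Set Cantor} (h : Z ⊆ Z')
    (P : Finset ℕ) (U : Finset ℕ → Set E) : cubeSet w Z P U ⊆ cubeSet w Z' P U :=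
  fun _ hz => ⟨hz.1, fun F hF => ⟨(hz.2 F hF).1, h (hz.2 F hF).2⟩⟩

theorem cubeSet_congr {E : Type*} {w : E → Cantor} {Z : Set Cantor} {P : Finset ℕ}
    {U U' : Finset ℕ → Set E} (h : ∀ F ⊆ P, U F = U' F) :
    cubeSet w Z P U = cubeSet w Z P U' := by
  ext z
  refine and_congr_right fun _ => forall₂_congr fun F hF => ?_
  rw [h F hF]

theorem exists_core {E : Type*} (w : E → Cantor) {b : Set (Set E)} (hb : b.Countable) :
    ∃ Z : Set Cantor, MeasurableSet Z ∧ CountablyColorable univ Zᶜ ∧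
      ∀ (P : Finset ℕ) (U : Finset ℕ → Set E), (∀ F ⊆ P, U F ∈ b) →
        (cubeSet w Z P U).Nonempty → ¬ CountablyColorable univ (cubeSet w Z P U) := by
  have := hb.to_subtype
  let I := Σ P : Finset ℕ, P.powerset → b
  let V : I → Finset ℕ → Set E := fun i F => if h : F ∈ i.1.powerset then i.2 ⟨F, h⟩ else ∅
  have hex : ∀ i : I, ∃ Z : Set Cantor, MeasurableSet Z ∧ CountablyColorable univ Zᶜ ∧
      ∀ Z', MeasurableSet Z' → CountablyColorable univ Z'ᶜ → cubeSet w Z' i.1 (V i) = ∅ →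
        cubeSet w Z i.1 (V i) = ∅ := by
    intro i
    by_cases h : ∃ Z', MeasurableSet Z' ∧ CountablyColorable univ Z'ᶜ ∧
        cubeSet w Z' i.1 (V i) = ∅
    · obtain ⟨Z, h1, h2, h3⟩ := h
      exact ⟨Z, h1, h2, fun _ _ _ _ => h3⟩
    · refine ⟨univ, MeasurableSet.univ, ?_, fun Z' h1 h2 h3 => absurd ⟨Z', h1, h2, h3⟩ h⟩
      rw [compl_univ]
      exact .of_independent MeasurableSet.empty fun x hx => hx.elim
  choose Z hZm hZc hZ using hex
  have hm : MeasurableSet (⋂ i, Z i) := MeasurableSet.iInter hZm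
  have hc : CountablyColorable univ (⋂ i, Z i)ᶜ := by
    rw [compl_iInter]
    exact .iUnion hZc
  refine ⟨⋂ i, Z i, hm, hc, fun P U hU ⟨z, hz⟩ hcol => ?_⟩
  let i : I := ⟨P, fun F => ⟨U F, hU F (Finset.mem_powerset.1 F.2)⟩⟩
  have hV : ∀ Y, cubeSet w Y P U = cubeSet w Y P (V i) := fun Y => cubeSet_congr fun F hF => by
    simp [V, i, hF]
  obtain ⟨H, hHm, hQH, hH⟩ := hcol.exists_measurable_superset
  have hempty : cubeSet w ((⋂ i, Z i) \ H) P U = ∅ := by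
    refine eq_empty_of_forall_notMem fun x hx => ?_
    have h := (hx.2 ∅ (Finset.empty_subset _)).2.2
    rw [orFin_empty] at h
    exact h (hQH (cubeSet_mono sdiff_subset P U hx))
  rw [hV] at hempty
  have h0 := hZ i _ (hm.diff hHm) (by
    rw [compl_sdiff]
    exact hH.union hc) hempty
  have h1 : z ∈ cubeSet w (Z i) P (V i) := by
    rw [← hV]
    exact cubeSet_mono (iInter_subset _ i) P U hz
  rw [h0] at h1
  exact h1

section CubeStage

variable {E : Type*} [TopologicalSpace E] {w : E → Cantor}

open MeasureTheory in
theorem analyticSet_cubeSet [PolishSpace E] (hw : Continuous w) {Z : Set Cantor}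
    (hZ : MeasurableSet Z) {P : Finset ℕ} {U : Finset ℕ → Set E} (hU : ∀ F ⊆ P, IsOpen (U F)) :
    AnalyticSet (cubeSet w Z P U) := by
  have h : cubeSet w Z P U = {z | ∀ m ∈ P, z m = false} ∩
      ⋂ F : P.powerset, (fun z => orFin z F) ⁻¹' (w '' U F ∩ Z) := by
    ext z
    simp [cubeSet]
  have : Nonempty P.powerset := ⟨⟨∅, Finset.empty_mem_powerset P⟩⟩
  rw [h]
  refine analyticSet_inter (IsClosed.analyticSet ?_) (AnalyticSet.iInter fun F => ?_)
  · simp only [ofPred_forall]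
    exact isClosed_iInter fun m => isClosed_iInter fun _ =>
      isClosed_eq (continuous_apply m) continuous_const
  · exact (analyticSet_inter ((hU F (Finset.mem_powerset.1 F.2)).analyticSet_image hw)
      hZ.analyticSet).preimage (continuous_orFin F)

open TopologicalSpace in
/-- A finite stage of the construction of a cube of points of `E` which lifts a copy of `2^ω`. -/
structure CubeStage [SecondCountableTopology E] (w : E → Cantor) (Z : Set Cantor) (l : ℕ)
    (P : Finset ℕ) (U : Finset ℕ → Set E) : Prop where
  lt : ∀ m ∈ P, m < l
  mem_basis : ∀ F ⊆ P, U F ∈ countableBasis E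
  agree : ∀ F ⊆ P, ∀ a ∈ U F, ∀ b ∈ U F, ∀ i < l, w a i = w b i
  nonempty : (cubeSet w Z P U).Nonempty

end CubeStage

open TopologicalSpace ENNReal in
theorem CubeStage.exists_succ {E : Type*} [PseudoEMetricSpace E] [PolishSpace E]
    {w : E → Cantor} (hw : Continuous w) {Z : Set Cantor} (hZ : MeasurableSet Z)
    (hcore : ∀ (P : Finset ℕ) (U : Finset ℕ → Set E), (∀ F ⊆ P, U F ∈ countableBasis E) →
      (cubeSet w Z P U).Nonempty → ¬ CountablyColorable univ (cubeSet w Z P U))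
    {l : ℕ} {P : Finset ℕ} {U : Finset ℕ → Set E} (h : CubeStage w Z l P U) {T : Set ℕ} {k : ℕ}
    (hT : ∀ c, ∃ j ≤ k, c + j ∈ T) {ε : ℝ≥0∞} (hε : 0 < ε) :
    ∃ M ≥ l, ∃ U' : Finset ℕ → Set E, CubeStage w Z (M + 1) (insert M P) U' ∧
      (∀ F ⊆ insert M P, closure (U' F) ⊆ U (F.erase M) ∧ Metric.ediam (U' F) ≤ ε) ∧
      ∀ x ∈ U' ∅, cardOnes (w x) M ∈ T := by
  have hb := isBasis_countableBasis E
  have hnc := hcore P U h.mem_basis h.nonempty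
  have hni : ¬ Independent T (cubeSet w Z P U) := fun hi => hnc <|
    (CountablyColorable.of_analyticSet (analyticSet_cubeSet hw hZ fun F hF =>
      hb.isOpen (h.mem_basis F hF)) hi).of_syndetic hT
  simp only [Independent, not_forall, not_not] at hni
  obtain ⟨x, hx, y, hy, hxy⟩ := hni
  obtain ⟨n, hn, hnT, rfl⟩ := mem_ASet.1 hxy
  have hln : l ≤ n := by
    by_contra! hlt
    obtain ⟨a, ha, hax⟩ := (hx.2 ∅ (Finset.empty_subset _)).1
    obtain ⟨b, hb, hby⟩ := (hy.2 ∅ (Finset.empty_subset _)).1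
    have := h.agree ∅ (Finset.empty_subset _) a ha b hb n hlt
    rw [hax, hby, orFin_empty, orFin_empty, hn] at this
    simp at this
  have hpt : ∀ F ⊆ insert n P, orFin x F ∈ w '' U (F.erase n) ∩ Z := by
    intro F hF
    have hFP : F.erase n ⊆ P := Finset.subset_insert_iff.1 hF
    by_cases hnF : n ∈ F
    · rw [← orFin_update_erase hnF]
      exact hy.2 _ hFP
    · rw [Finset.erase_eq_of_notMem hnF] at hFP ⊢
      exact hx.2 F hFP
  have hnb : ∀ F ⊆ insert n P, ∃ V ∈ countableBasis E, orFin x F ∈ w '' V ∧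
      closure V ⊆ U (F.erase n) ∧ Metric.ediam V ≤ ε ∧
      ∀ a ∈ V, ∀ i < n + 1, w a i = orFin x F i := by
    intro F hF
    obtain ⟨⟨e, he, hex⟩, -⟩ := hpt F hF
    have hFP : F.erase n ⊆ P := Finset.subset_insert_iff.1 hF
    have hcyl : w ⁻¹' PiNat.cylinder (E := fun _ => Bool) (w e) (n + 1) ∈ 𝓝 e :=
      ((PiNat.isOpen_cylinder _ _ _).preimage hw).mem_nhds (PiNat.self_mem_cylinder _ _)
    obtain ⟨V, hV, heV, hVs⟩ := hb.exists_closure_subset (Filter.inter_mem (Filter.inter_mem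
      ((hb.isOpen (h.mem_basis _ hFP)).mem_nhds he) hcyl)
      (Metric.eball_mem_nhds e (ENNReal.half_pos hε.ne')))
    refine ⟨V, hV, ⟨e, heV, hex⟩, fun a ha => (hVs ha).1.1, ?_, fun a ha i hi => ?_⟩
    · refine (Metric.ediam_mono fun a ha => (hVs (subset_closure ha)).2).trans
        (Metric.ediam_eball_le.trans_eq ?_)
      exact ENNReal.mul_div_cancel two_ne_zero ofNat_ne_top
    · rw [← hex]
      exact PiNat.mem_cylinder_iff.1 (hVs (subset_closure ha)).1.2 i hi
  choose! U' hU'b hU'x hU'U hU'ε hU'a using hnb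
  refine ⟨n, hln, U', ⟨?_, hU'b, fun F hF a ha b hb i hi => ?_, x, ?_, fun F hF =>
    ⟨hU'x F hF, (hpt F hF).2⟩⟩, fun F hF => ⟨hU'U F hF, hU'ε F hF⟩, fun a ha => ?_⟩
  · intro m hm
    rcases Finset.mem_insert.1 hm with rfl | hm
    · exact m.lt_succ_self
    · have := h.lt m hm
      omega
  · rw [hU'a F hF a ha i hi, hU'a F hF b hb i hi]
  · intro m hm
    rcases Finset.mem_insert.1 hm with rfl | hm
    exacts [hn, hx.1 m hm]
  · rwa [cardOnes_congr fun i hi => (hU'a ∅ (Finset.empty_subset _) a ha i (by omega)).trans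
      (congrFun (orFin_empty x) i)]

/-- The set of positions `M k` for which the `k`-th entry (from the end) of the list is `true`. -/
def onesAlong (M : ℕ → ℕ) : List Bool → Finset ℕ
  | [] => ∅
  | b :: s => if b then insert (M s.length) (onesAlong M s) else onesAlong M s

theorem mem_onesAlong_res {M : ℕ → ℕ} {α : Cantor} {n i : ℕ} :
    i ∈ onesAlong M (PiNat.res α n) ↔ ∃ k < n, M k = i ∧ α k = true := by
  induction n with
  | zero => simp [onesAlong]
  | succ n ih =>
    simp only [PiNat.res_succ, onesAlong, PiNat.res_length, Nat.lt_succ_iff_lt_or_eq]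
    split_ifs with h
    · rw [Finset.mem_insert, ih]
      constructor
      · rintro (rfl | ⟨k, hk, h'⟩)
        exacts [⟨n, Or.inr rfl, rfl, h⟩, ⟨k, Or.inl hk, h'⟩]
      · rintro ⟨k, hk | rfl, h', h''⟩
        exacts [Or.inr ⟨k, hk, h', h''⟩, Or.inl h'.symm]
    · rw [ih]
      constructor
      · rintro ⟨k, hk, h'⟩
        exact ⟨k, Or.inl hk, h'⟩
      · rintro ⟨k, hk | rfl, h', h''⟩
        exacts [⟨k, hk, h', h''⟩, absurd h'' h]

open TopologicalSpace ENNReal Filter in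
theorem exists_cube {E : Type*} [TopologicalSpace E] [PolishSpace E] {w : E → Cantor}
    (hw : Continuous w) (hrange : ¬ CountablyColorable univ (range w)) {T : ℕ → Set ℕ}
    (hT : ∀ p, ∃ k, ∀ c, ∃ j ≤ k, c + j ∈ T p) :
    ∃ φ : Cantor → E, Continuous φ ∧ ∃ (z : Cantor) (M : ℕ → ℕ), StrictMono M ∧
      (∀ k, z (M k) = false) ∧ (∀ k, cardOnes z (M k) ∈ T k) ∧ ∀ α, w (φ α) = emb z M α := by
  let := upgradeIsCompletelyMetrizable E
  obtain ⟨Z, hZm, hZc, hZ⟩ := exists_core w (countable_countableBasis E)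
  have hne : ∃ x, w x ∈ Z := by
    by_contra! hcon
    exact hrange (hZc.subset (range_subset_iff.2 hcon))
  obtain ⟨x₀, hx₀⟩ := hne
  obtain ⟨V, hV, hxV, -⟩ := (isBasis_countableBasis E).exists_subset_of_mem_open
    (mem_univ x₀) isOpen_univ
  have hinit : CubeStage w Z 0 ∅ fun _ => V :=
    ⟨by simp, fun _ _ => hV, fun _ _ _ _ _ _ i hi => absurd hi (Nat.not_lt_zero i), w x₀,
      by simp, fun F hF => by
        rw [Finset.subset_empty.1 hF, orFin_empty]
        exact ⟨⟨x₀, hxV, rfl⟩, hx₀⟩⟩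
  choose k hk using hT
  let St := {s : ℕ × Finset ℕ × (Finset ℕ → Set E) // CubeStage w Z s.1 s.2.1 s.2.2}
  have hstep : ∀ (p : ℕ) (s : St), ∃ M ≥ s.1.1, ∃ s' : St, s'.1.1 = M + 1 ∧
      s'.1.2.1 = insert M s.1.2.1 ∧
      (∀ F ⊆ insert M s.1.2.1, closure (s'.1.2.2 F) ⊆ s.1.2.2 (F.erase M) ∧
        Metric.ediam (s'.1.2.2 F) ≤ (p : ℝ≥0∞)⁻¹) ∧
      ∀ x ∈ s'.1.2.2 ∅, cardOnes (w x) M ∈ T p := by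
    rintro p ⟨⟨l, P, U⟩, h⟩
    obtain ⟨M, hM, U', h', hF, hx⟩ := h.exists_succ hw hZm hZ (hk p)
      (ε := (p : ℝ≥0∞)⁻¹) (ENNReal.inv_pos.2 (ENNReal.natCast_ne_top p))
    exact ⟨M, hM, ⟨⟨M + 1, insert M P, U'⟩, h'⟩, rfl, rfl, hF, hx⟩
  choose N hN nxt hnxt_l hnxt_P hnxt_U hnxt_T using hstep
  let st : ℕ → St := fun n => Nat.rec ⟨(0, ∅, fun _ => V), hinit⟩ nxt n
  let M : ℕ → ℕ := fun n => N n (st n)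
  let l : ℕ → ℕ := fun n => (st n).1.1
  let P : ℕ → Finset ℕ := fun n => (st n).1.2.1
  let U : ℕ → Finset ℕ → Set E := fun n => (st n).1.2.2
  have hst : ∀ n, CubeStage w Z (l n) (P n) (U n) := fun n => (st n).2
  have hlM : ∀ n, l n ≤ M n := fun n => hN n (st n)
  have hl : ∀ n, l (n + 1) = M n + 1 := fun n => hnxt_l n (st n)
  have hP : ∀ n, P (n + 1) = insert (M n) (P n) := fun n => hnxt_P n (st n)
  have hU : ∀ n, ∀ F ⊆ P (n + 1), closure (U (n + 1) F) ⊆ U n (F.erase (M n)) ∧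
      Metric.ediam (U (n + 1) F) ≤ (n : ℝ≥0∞)⁻¹ := fun n F hF =>
    hnxt_U n (st n) F (hP n ▸ hF)
  have hcard : ∀ n, ∀ x ∈ U (n + 1) ∅, cardOnes (w x) (M n) ∈ T n := fun n => hnxt_T n (st n)
  have hM : StrictMono M := strictMono_nat_of_lt_succ fun n => by
    have := hlM (n + 1)
    rw [hl] at this
    exact this
  have hnl : ∀ n, n ≤ l n := by
    intro n
    induction n with
    | zero => exact Nat.zero_le _
    | succ n ih =>
      rw [hl]
      exact Nat.succ_le_succ (ih.trans (hlM n))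
  have hones : ∀ s : List Bool, onesAlong M s ⊆ P s.length := by
    intro s
    induction s with
    | nil => exact Finset.empty_subset _
    | cons b s ih =>
      simp only [List.length_cons, hP, onesAlong]
      split_ifs
      · exact Finset.insert_subset_insert _ ih
      · exact ih.trans (Finset.subset_insert _ _)
  have hMP : ∀ n, M n ∉ P n := fun n h => ((hst n).lt _ h).not_ge (hlM n)
  let A : List Bool → Set E := fun s => U s.length (onesAlong M s)
  have hanti : CantorScheme.ClosureAntitone A := by
    intro s b
    refine ((hU s.length _ (hones (b :: s))).1).trans_eq ?_
    have hMs : M s.length ∉ onesAlong M s := fun h => hMP _ (hones s h)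
    change U _ _ = U _ _
    congr 1
    cases b <;> simp [onesAlong, hMs]
  have hdiam : CantorScheme.VanishingDiam A := by
    intro α
    rw [← tendsto_add_atTop_iff_nat 1]
    refine tendsto_of_tendsto_of_tendsto_of_le_of_le tendsto_const_nhds
      ENNReal.tendsto_inv_nat_nhds_zero (fun n => zero_le) fun n => ?_
    have h := (hU n (onesAlong M (PiNat.res α (n + 1)))
      (by simpa using hones (PiNat.res α (n + 1)))).2
    simpa [A] using h
  have hnonempty : ∀ s, (A s).Nonempty := by
    intro s
    obtain ⟨x, hx⟩ := (hst s.length).nonempty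
    obtain ⟨a, ha, -⟩ := (hx.2 _ (hones s)).1
    exact ⟨a, ha⟩
  have hdom := CantorScheme.ClosureAntitone.map_of_vanishingDiam hdiam hanti hnonempty
  let φ : Cantor → E := fun α => (CantorScheme.inducedMap A).2 ⟨α, hdom ▸ mem_univ α⟩
  have hφ : Continuous φ := hdiam.map_continuous.comp (continuous_id.subtype_mk _)
  have hmem : ∀ α n, φ α ∈ U n (onesAlong M (PiNat.res α n)) := fun α n => by
    have h := CantorScheme.map_mem (A := A) ⟨α, hdom ▸ mem_univ α⟩ n
    simpa [A] using h
  let o : Cantor := fun _ => false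
  have ho : ∀ n, onesAlong M (PiNat.res o n) = ∅ := fun n => by
    refine Finset.eq_empty_of_forall_notMem fun i hi => ?_
    obtain ⟨k, -, -, h⟩ := mem_onesAlong_res.1 hi
    cases h
  have hbase : ∀ n, ∃ x : Cantor, (∀ m ∈ P n, x m = false) ∧ ∀ α, ∀ i < l n,
      w (φ α) i = (x i || decide (i ∈ onesAlong M (PiNat.res α n))) := by
    intro n
    obtain ⟨x, hx⟩ := (hst n).nonempty
    refine ⟨x, hx.1, fun α i hi => ?_⟩
    have hs : onesAlong M (PiNat.res α n) ⊆ P n := by simpa using hones (PiNat.res α n)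
    obtain ⟨a, ha, hax⟩ := (hx.2 _ hs).1
    rw [(hst n).agree _ hs _ (hmem α n) a ha i hi, hax]
    rfl
  refine ⟨φ, hφ, w (φ o), M, hM, fun k => ?_, fun k => ?_, fun α => ?_⟩
  · obtain ⟨x, hx, hφx⟩ := hbase (k + 1)
    rw [hφx o (M k) (by rw [hl]; exact Nat.lt_succ_self _), ho, hx _ (by rw [hP]; simp)]
    simp
  · have h := hmem o (k + 1)
    rw [ho] at h
    exact hcard k _ h
  · ext1 i
    obtain ⟨x, -, hφx⟩ := hbase (i + 1)
    have hi : i < l (i + 1) := hnl (i + 1)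
    have h0 : w (φ o) i = x i := by rw [hφx o i hi, ho]; simp
    have hiff : (i ∈ onesAlong M (PiNat.res α (i + 1))) ↔ ∃ k, M k = i ∧ α k = true := by
      rw [mem_onesAlong_res]
      constructor
      · rintro ⟨k, -, h⟩
        exact ⟨k, h⟩
      · rintro ⟨k, rfl, h⟩
        exact ⟨k, Nat.lt_succ_of_le (hM.id_le k), rfl, h⟩
    rw [hφx α i hi, emb, h0, decide_eq_decide.2 hiff]

theorem minNonPotClosed_ASet {S : Set ℕ} (hS : ∀ N, ∃ c ≥ N, c ∈ S)
    (hrec : ∀ p, ∃ k, ∀ c, ∃ j ≤ k, ∀ i ≤ p, (c + j + i ∈ S ↔ i ∈ S)) :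
    MinNonPotClosed inferInstance inferInstance (ASet S) := by
  refine ⟨not_potClosed_ASet hS, ?_⟩
  rintro X Y tX tY hX hY A - hA ⟨u, v, hu, hv, rfl⟩
  let E := {p : X × Y // u p.1 = v p.2}
  have hE : PolishSpace E :=
    (isClosed_eq (hu.comp continuous_fst) (hv.comp continuous_snd)).polishSpace
  let w : E → Cantor := fun p => u p.1.1
  have hw : Continuous w := hu.comp (continuous_fst.comp continuous_subtype_val)
  have hrange : ¬ CountablyColorable univ (range w) := fun h =>
    hA <| potClosed_preimage_ASet hu hv <| (h.mono (subset_univ S)).subset <| by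
      rintro z ⟨x, y, hx, hy⟩
      exact ⟨⟨(x, y), hx.trans hy.symm⟩, hx⟩
  obtain ⟨φ, hφ, z, M, hM, hz, hcard, hφw⟩ :=
    exists_cube hw hrange (T := fun p => {c | ∀ i ≤ p, (c + i ∈ S ↔ i ∈ S)}) hrec
  refine ⟨fun α => (φ α).1.1, fun β => (φ β).1.2,
    continuous_fst.comp (continuous_subtype_val.comp hφ),
    continuous_snd.comp (continuous_subtype_val.comp hφ), ?_⟩
  ext ⟨α, β⟩
  have h1 : u (φ α).1.1 = emb z M α := hφw α
  have h2 : v (φ β).1.2 = emb z M β := (φ β).2.symm.trans (hφw β)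
  rw [mem_preimage, mem_preimage, h1, h2, emb_mem_ASet_iff hM hz hcard]

theorem diagonal_mem_closure_ASet {S : Set ℕ} (hS : ∀ N, ∃ c ≥ N, c ∈ S) (x : Cantor) :
    (x, x) ∈ closure (ASet S) := by
  rw [mem_closure_iff]
  intro O hO hx
  obtain ⟨U, V, hU, hV, hxU, hxV, hUV⟩ := isOpen_prod_iff.1 hO x x hx
  obtain ⟨l, hl⟩ := exists_cylinder_subset (hU.inter hV) ⟨hxU, hxV⟩
  obtain ⟨n, hn, y, hy, hyn, hyS⟩ := exists_edge hS x l
  refine ⟨(y, Function.update y n true), hUV ⟨(hl y hy).1, (hl _ fun i hi => ?_).2⟩,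
    mem_ASet.2 ⟨n, hyn, hyS, rfl⟩⟩
  exact (Function.update_of_ne (by omega) _ _).trans (hy i hi)

theorem eq_of_reduction {S S' : Set ℕ} (hS : ∀ N, ∃ c ≥ N, c ∈ S) {u v : Cantor → Cantor}
    (hu : Continuous u) (hv : Continuous v)
    (h : ASet S = (fun p : Cantor × Cantor => (u p.1, v p.2)) ⁻¹' ASet S') : u = v := by
  ext1 x
  have hcl := (isClosed_ASet_union_diagonal S').preimage
    ((hu.comp continuous_fst).prodMk (hv.comp continuous_snd))
  have hsub := closure_minimal (h.subset.trans (preimage_mono subset_union_left)) hcl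
  rcases hsub (diagonal_mem_closure_ASet hS x) with hx | hx
  · exact absurd (h.superset hx) (not_mem_ASet_self S x)
  · exact hx

theorem emb_update_mem_ASet {z : Cantor} {M : ℕ → ℕ} (hM : StrictMono M)
    (hz : ∀ k, z (M k) = false) {S : Set ℕ} {α : Cantor} {k : ℕ} (hk : α k = false) :
    (emb z M α, emb z M (Function.update α k true)) ∈ ASet S ↔
      cardOnes z (M k) + cardOnes α k ∈ S := by
  rw [emb_mem_ASet hM hz]
  constructor
  · rintro ⟨m, hm, hmS, h⟩
    have := congrFun h k
    obtain rfl : k = m := by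
      by_contra hkm
      rw [Function.update_self, Function.update_of_ne hkm, hk] at this
      cases this
    exact hmS
  · exact fun h => ⟨k, hk, h, rfl⟩

/-- The characteristic function of a finite set. -/
def finChar (F : Finset ℕ) : Cantor := fun i => decide (i ∈ F)

theorem finChar_insert (a : ℕ) (F : Finset ℕ) :
    finChar (insert a F) = Function.update (finChar F) a true := by
  ext1 i
  by_cases hi : i = a
  · subst hi
    simp [finChar]
  · simp [finChar, hi]

theorem exists_emb_of_reduction {S S' : Set ℕ} (h0 : 0 ∈ S) {u : Cantor → Cantor}
    (hu : Continuous u) (h : ∀ x y, (x, y) ∈ ASet S → (u x, u y) ∈ ASet S') :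
    ∃ (z : Cantor) (M N : ℕ → ℕ), StrictMono M ∧ StrictMono N ∧ (∀ k, z (N k) = false) ∧
      ∀ F, u (emb (fun _ => false) M (finChar F)) = emb z N (finChar F) := by
  let o : Cantor := fun _ => false
  have hcard : ∀ {x : Cantor} {n : ℕ}, (∀ i < n, x i = false) → cardOnes x n = 0 := fun hx => by
    rw [cardOnes_eq_card, Finset.card_eq_zero]
    refine Finset.filter_eq_empty_iff.2 fun i hi => ?_
    simp [hx i (Finset.mem_range.1 hi)]
  have hedge : ∀ {x : Cantor} {n : ℕ}, (∀ i ≤ n, x i = false) → ∃ m, u x m = false ∧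
      u (Function.update x n true) = Function.update (u x) m true := fun {x n} hx => by
    have hxS : cardOnes x n ∈ S := by rwa [hcard fun i hi => hx i hi.le]
    obtain ⟨m, hm, -, hm'⟩ := mem_ASet.1 (h _ _ (mem_ASet.2 ⟨n, hx n le_rfl, hxS, rfl⟩))
    exact ⟨m, hm, hm'⟩
  choose N hN hN' using fun n => hedge (x := o) (n := n) fun _ _ => rfl
  have hlim : ∀ B, ∃ l, ∀ n ≥ l, B ≤ N n := by
    intro B
    obtain ⟨l, hl⟩ := exists_cylinder_subset
      ((PiNat.isOpen_cylinder (fun _ => Bool) (u o) B).preimage hu)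
      (x := o) (PiNat.self_mem_cylinder _ _)
    refine ⟨l, fun n hn => ?_⟩
    by_contra! hlt
    have := PiNat.mem_cylinder_iff.1 (hl (Function.update o n true) fun i hi =>
      Function.update_of_ne (by omega) _ _) _ hlt
    rw [hN' n, Function.update_self, hN n] at this
    cases this
  have hloc : ∀ n, ∃ l > n, ∀ x : Cantor, (∀ i < l, x i = false) →
      u (Function.update x n true) = Function.update (u x) (N n) true := by
    intro n
    have hop : IsOpen {x | u x (N n) = false ∧ u (Function.update x n true) (N n) = true} :=
      ((isOpen_discrete ({false} : Set Bool)).preimage ((continuous_apply (N n)).comp hu)).inter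
        ((isOpen_discrete ({true} : Set Bool)).preimage
          ((continuous_apply (N n)).comp (hu.comp (continuous_fSfun n))))
    obtain ⟨l, hl⟩ := exists_cylinder_subset hop (x := o) ⟨hN n, by
      rw [hN' n, Function.update_self]⟩
    refine ⟨max l (n + 1), by simp, fun x hx => ?_⟩
    obtain ⟨hx1, hx2⟩ := hl x fun i hi => hx i (lt_max_of_lt_left hi)
    obtain ⟨m, -, hm⟩ := hedge (x := x) (n := n) fun i hi =>
      hx i (lt_max_of_lt_right (Nat.lt_succ_of_le hi))
    obtain rfl : N n = m := by
      by_contra hne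
      rw [hm, Function.update_of_ne hne, hx1] at hx2
      cases hx2
    exact hm
  choose l hl hloc using hloc
  have hnext : ∀ n, ∃ m ≥ l n, N n < N m := fun n => by
    obtain ⟨k, hk⟩ := hlim (N n + 1)
    exact ⟨max (l n) k, le_max_left _ _, hk _ (le_max_right _ _)⟩
  choose nxt hnxt hnxtN using hnext
  let M : ℕ → ℕ := fun k => Nat.rec 0 (fun _ m => nxt m) k
  have hMl : ∀ k, l (M k) ≤ M (k + 1) := fun k => hnxt (M k)
  have hM : StrictMono M := strictMono_nat_of_lt_succ fun k => (hl _).trans_le (hMl k)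
  have hNM : StrictMono (N ∘ M) := strictMono_nat_of_lt_succ fun k => hnxtN (M k)
  refine ⟨u o, M, N ∘ M, hM, hNM, fun k => hN _, fun F => ?_⟩
  induction F using Finset.induction_on_min with
  | empty =>
    have : finChar ∅ = fun _ => false := by
      ext1 i
      simp [finChar]
    rw [this, emb_zero, emb_zero]
  | insert a F ha ih =>
    rw [finChar_insert, emb_update hM (fun _ => rfl), emb_update hNM (fun k => hN _),
      hloc, ih]
    · rfl
    · intro i hi
      have : ¬ ∃ k, M k = i ∧ finChar F k = true := by
        rintro ⟨k, rfl, hk⟩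
        have hak := ha k (by simpa [finChar] using hk)
        exact (hi.trans_le ((hMl a).trans (hM.monotone hak))).false
      simp [emb, this]

theorem exists_shift_of_redC2 {S S' : Set ℕ} (hS : ∀ N, ∃ c ≥ N, c ∈ S) (h0 : 0 ∈ S)
    (h : RedC2 (ASet S) (ASet S')) (p : ℕ) : ∃ c, ∀ j ≤ p, (j ∈ S ↔ c + j ∈ S') := by
  obtain ⟨u, v, hu, hv, huv⟩ := h
  obtain rfl := eq_of_reduction hS hu hv huv
  have hiff : ∀ x y, (x, y) ∈ ASet S ↔ (u x, u y) ∈ ASet S' := fun x y => by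
    conv_lhs => rw [huv]
    rfl
  obtain ⟨z, M, N, hM, hN, hz, hF⟩ := exists_emb_of_reduction h0 hu fun x y => (hiff x y).1
  refine ⟨cardOnes z (N p), fun j hj => ?_⟩
  have hp : finChar (Finset.range j) p = false := by simp [finChar, hj]
  have hcard : cardOnes (finChar (Finset.range j)) p = j := by
    rw [cardOnes_eq_card]
    have : (Finset.range p).filter (fun i => finChar (Finset.range j) i = true) =
        Finset.range j := by
      ext i
      simp only [finChar, Finset.mem_filter, Finset.mem_range, decide_eq_true_eq]
      omega
    rw [this, Finset.card_range]
  have hcard0 : cardOnes (fun _ => false) (M p) = 0 := by simp [cardOnes]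
  have h1 := emb_update_mem_ASet hM (z := fun _ => false) (fun _ => rfl) (S := S) hp
  have h2 := emb_update_mem_ASet hN hz (S := S') hp
  rw [← finChar_insert, hcard] at h1 h2
  rw [hcard0, Nat.zero_add] at h1
  rw [← h1, ← h2, hiff, hF, hF]

/-- The Toeplitz-like set of those `m` such that `γ` holds at the `2`-adic valuation of `m + 1`. -/
def toeplitzSet (γ : Cantor) : Set ℕ := {m | γ (padicValNat 2 (m + 1)) = true}

theorem padicValNat_two_mul_add_one (i : ℕ) : padicValNat 2 (2 * i + 1) = 0 :=
  padicValNat.eq_zero_of_not_dvd (by omega)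

theorem padicValNat_two_mul_succ (i : ℕ) :
    padicValNat 2 (2 * i + 1 + 1) = padicValNat 2 (i + 1) + 1 := by
  rw [show 2 * i + 1 + 1 = 2 * (i + 1) by ring, padicValNat.mul two_ne_zero i.succ_ne_zero,
    padicValNat.self one_lt_two, add_comm]

theorem two_mul_mem_toeplitzSet {γ : Cantor} {i : ℕ} :
    2 * i ∈ toeplitzSet γ ↔ γ 0 = true := by
  rw [toeplitzSet, mem_ofPred_eq, padicValNat_two_mul_add_one]

theorem two_mul_add_one_mem_toeplitzSet {γ : Cantor} {i : ℕ} :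
    2 * i + 1 ∈ toeplitzSet γ ↔ i ∈ toeplitzSet fun n => γ (n + 1) := by
  rw [toeplitzSet, mem_ofPred_eq, padicValNat_two_mul_succ]
  rfl

theorem two_pow_sub_one_mem_toeplitzSet {γ : Cantor} {a : ℕ} :
    2 ^ a - 1 ∈ toeplitzSet γ ↔ γ a = true := by
  rw [toeplitzSet, mem_ofPred_eq, Nat.sub_add_cancel Nat.one_le_two_pow, padicValNat.prime_pow]

theorem toeplitzSet_unbounded {γ : Cantor} (h : γ 0 = true) (N : ℕ) :
    ∃ c ≥ N, c ∈ toeplitzSet γ :=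
  ⟨2 * N, by omega, two_mul_mem_toeplitzSet.2 h⟩

theorem toeplitzSet_recurrent (γ : Cantor) (p : ℕ) :
    ∃ k, ∀ c, ∃ j ≤ k, ∀ i ≤ p, (c + j + i ∈ toeplitzSet γ ↔ i ∈ toeplitzSet γ) := by
  have hpow : p + 1 < 2 ^ (p + 1) := Nat.lt_two_pow_self
  refine ⟨2 ^ (p + 1), fun c => ⟨2 ^ (p + 1) - c % 2 ^ (p + 1), Nat.sub_le _ _, fun i hi => ?_⟩⟩
  have hdvd : 2 ^ (p + 1) ∣ c + (2 ^ (p + 1) - c % 2 ^ (p + 1)) := by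
    refine ⟨c / 2 ^ (p + 1) + 1, ?_⟩
    have h1 := Nat.div_add_mod c (2 ^ (p + 1))
    have h2 := Nat.mod_lt c (Nat.two_pow_pos (p + 1))
    rw [mul_add]
    omega
  generalize c + (2 ^ (p + 1) - c % 2 ^ (p + 1)) = c' at hdvd ⊢
  have hval : padicValNat 2 (c' + i + 1) = padicValNat 2 (i + 1) := by
    have hlt : ∀ n, 2 ^ n ∣ i + 1 → n ≤ p + 1 := fun n hn => by
      have := (Nat.le_of_dvd i.succ_pos hn).trans_lt (by omega : i + 1 < 2 ^ (p + 1))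
      exact ((Nat.pow_lt_pow_iff_right one_lt_two).1 this).le
    refine eq_of_forall_le_iff fun n => ?_
    rw [← padicValNat_dvd_iff_le (by omega), ← padicValNat_dvd_iff_le (by omega), add_assoc]
    constructor
    · intro h
      rcases le_total n (p + 1) with hn | hn
      · exact (Nat.dvd_add_right ((pow_dvd_pow 2 hn).trans hdvd)).1 h
      · have h' := (Nat.dvd_add_right hdvd).1 ((pow_dvd_pow 2 hn).trans h)
        have := Nat.le_of_dvd i.succ_pos h'
        omega
    · intro h
      exact (Nat.dvd_add_right ((pow_dvd_pow 2 (hlt n h)).trans hdvd)).2 h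
  rw [toeplitzSet, mem_ofPred_eq, mem_ofPred_eq, hval]

theorem toeplitzSet_shift_step {γ γ' : Cantor} {a b : ℕ} (ha : γ (a + 1) = true)
    (hb : γ (b + 1) = false)
    (h : ∀ p, ∃ c, ∀ j ≤ p, (j ∈ toeplitzSet γ ↔ c + j ∈ toeplitzSet γ')) :
    γ 0 = γ' 0 ∧ ∀ p, ∃ c, ∀ j ≤ p, (j ∈ toeplitzSet (fun n => γ (n + 1)) ↔
      c + j ∈ toeplitzSet fun n => γ' (n + 1)) := by
  have key : ∀ p, ∃ c, ∀ j ≤ p, (j ∈ toeplitzSet γ ↔ 2 * c + j ∈ toeplitzSet γ') := by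
    intro p
    have hpa := Nat.two_pow_pos a
    have hpb := Nat.two_pow_pos b
    obtain ⟨c, hc⟩ := h (p + 2 ^ (a + 1) + 2 ^ (b + 1))
    rcases Nat.even_or_odd' c with ⟨c, rfl | rfl⟩
    · exact ⟨c, fun j hj => hc j (by omega)⟩
    · have hodd : ∀ n, 2 ^ (n + 1) ≤ p + 2 ^ (a + 1) + 2 ^ (b + 1) →
          (γ (n + 1) = true ↔ γ' 0 = true) := fun n hn => by
        have := Nat.two_pow_pos n
        rw [← two_pow_sub_one_mem_toeplitzSet, hc _ (by omega),
          ← two_mul_mem_toeplitzSet (i := c + 2 ^ n)]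
        rw [pow_succ, show 2 * c + 1 + (2 ^ n * 2 - 1) = 2 * (c + 2 ^ n) by omega]
      have h1 := (hodd a (by omega)).1 ha
      have h2 := (hodd b (by omega)).2 h1
      rw [hb] at h2
      cases h2
  refine ⟨?_, fun p => ?_⟩
  · obtain ⟨c, hc⟩ := key 0
    have := hc 0 le_rfl
    rw [add_zero, two_mul_mem_toeplitzSet, ← Nat.mul_zero 2, two_mul_mem_toeplitzSet] at this
    exact Bool.eq_iff_iff.2 this
  · obtain ⟨c, hc⟩ := key (2 * p + 1)
    refine ⟨c, fun j hj => ?_⟩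
    rw [← two_mul_add_one_mem_toeplitzSet, ← two_mul_add_one_mem_toeplitzSet, hc _ (by omega),
      show 2 * c + (2 * j + 1) = 2 * (c + j) + 1 by ring]

theorem eq_of_toeplitzSet_shift {γ γ' : Cantor} (hγ : ∀ b : Bool, ∀ n, ∃ a > n, γ a = b)
    (h : ∀ p, ∃ c, ∀ j ≤ p, (j ∈ toeplitzSet γ ↔ c + j ∈ toeplitzSet γ')) : γ = γ' := by
  ext1 n
  induction n generalizing γ γ' with
  | zero =>
    obtain ⟨_ | a, ha, ha'⟩ := hγ true 0
    · cases ha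
    obtain ⟨_ | b, hb, hb'⟩ := hγ false 0
    · cases hb
    exact (toeplitzSet_shift_step ha' hb' h).1
  | succ n ih =>
    obtain ⟨_ | a, ha, ha'⟩ := hγ true 0
    · cases ha
    obtain ⟨_ | b, hb, hb'⟩ := hγ false 0
    · cases hb
    refine ih (fun b m => ?_) (toeplitzSet_shift_step ha' hb' h).2
    obtain ⟨_ | k, hk, hk'⟩ := hγ b (m + 1)
    · cases hk
    · exact ⟨k, by omega, hk'⟩

theorem not_gammaSeq_zero (α : Cantor) : (!gammaSeq α 0) = true := by simp [gammaSeq]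

theorem exists_gt_not_gammaSeq_eq (α : Cantor) (b : Bool) (n : ℕ) :
    ∃ a > n, (!gammaSeq α a) = b := by
  cases b
  · refine ⟨4 * n + 2, by omega, ?_⟩
    rw [gammaSeq, if_neg (by omega), decide_eq_true (by omega), Bool.not_true]
  · refine ⟨4 * n + 4, by omega, ?_⟩
    rw [gammaSeq, if_neg (by omega), decide_eq_false (by omega), Bool.not_false]

theorem gammaSeq_two_mul_add_one (α : Cantor) (n : ℕ) : gammaSeq α (2 * n + 1) = α n := by
  rw [gammaSeq, if_pos (by omega), show (2 * n + 1) / 2 = n by omega]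

theorem eq_of_redC2_toeplitzSet {α α' : Cantor}
    (h : RedC2 (ASet (toeplitzSet fun k => !gammaSeq α k))
      (ASet (toeplitzSet fun k => !gammaSeq α' k))) : α = α' := by
  have h0 : 0 ∈ toeplitzSet fun k => !gammaSeq α k :=
    two_mul_mem_toeplitzSet (i := 0).2 (not_gammaSeq_zero α)
  have heq := eq_of_toeplitzSet_shift (exists_gt_not_gammaSeq_eq α)
    (exists_shift_of_redC2 (toeplitzSet_unbounded (not_gammaSeq_zero α)) h0 h)
  ext1 n
  have hn := congrFun heq (2 * n + 1)
  simpa only [gammaSeq_two_mul_add_one, Bool.not_inj_iff] using hn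

theorem stmt1 :
    ∃ A : Cantor → Set (Cantor × Cantor),
      (∀ α, D2Sigma01 inferInstance (A α) ∧
        MinNonPotClosed inferInstance inferInstance (A α)) ∧
      ∀ α α', α ≠ α' → ¬ RedC2 (A α) (A α') ∧ ¬ RedC2 (A α') (A α) :=
  ⟨fun α => ASet (toeplitzSet fun k => !gammaSeq α k),
    fun α => ⟨d2Sigma01_ASet _, minNonPotClosed_ASet
      (toeplitzSet_unbounded (not_gammaSeq_zero α)) (toeplitzSet_recurrent _)⟩,
    fun _ _ hne => ⟨fun h => hne (eq_of_redC2_toeplitzSet h),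
      fun h => hne (eq_of_redC2_toeplitzSet h).symm⟩⟩
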